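/- Let R be a principal ideal domain and let M be a finitely generated torsion R-module. Then Ext¹_R(M, R) is isomorphic to M as an R-module. -/

import Mathlib

open CategoryTheory Limits

namespace ExtTorsionAux

variable {R : Type} [CommRing R] {F M : Type} [AddCommGroup F] [Module R F]
  [AddCommGroup M] [Module R M]

/-- Objects of the two-term complex. -/
def cX (R F : Type) [CommRing R] [AddCommGroup F] [Module R F] : ℕ → ModuleCat.{0} R
  | 0 => ModuleCat.of R F
  | 1 => ModuleCat.of R F
  | _ + 2 => ModuleCat.of R PUnit

/-- Differentials of the two-term complex. -/
def cd (d : F →ₗ[R] F) : ∀ i j : ℕ, cX R F i ⟶ cX R F j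
  | 1, 0 => ModuleCat.ofHom d
  | _, _ => 0

lemma cd_ne (d : F →ₗ[R] F) (i j : ℕ) (h : ¬ (i = 1 ∧ j = 0)) : cd d i j = 0 := by
  match i, j, h with
  | 1, 0, h => exact absurd ⟨rfl, rfl⟩ h
  | 0, _, _ => rfl
  | 1, _ + 1, _ => rfl
  | _ + 2, _, _ => rfl

/-- The two-term complex. -/
def cplx (d : F →ₗ[R] F) : ChainComplex (ModuleCat.{0} R) ℕ where
  X := cX R F
  d := cd d
  shape i j h := by
    apply cd_ne
    rintro ⟨rfl, rfl⟩
    exact h rfl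
  d_comp_d' i j k _ _ := by
    by_cases h : i = 1 ∧ j = 0
    · rw [cd_ne d j k (by omega), comp_zero]
    · rw [cd_ne d i j h, zero_comp]

lemma cX_proj [Module.Free R F] (n : ℕ) : Projective (cX R F n) := by
  match n with
  | 0 => exact ModuleCat.projective_of_free (M := ModuleCat.of R F) (Module.Free.chooseBasis R F)
  | 1 => exact ModuleCat.projective_of_free (M := ModuleCat.of R F) (Module.Free.chooseBasis R F)
  | _ + 2 =>
    exact (ModuleCat.isZero_of_subsingleton (ModuleCat.of R PUnit)).projective

lemma cX_zero (n : ℕ) : IsZero (cX R F (n + 2)) :=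
  ModuleCat.isZero_of_subsingleton (ModuleCat.of R PUnit)

lemma exactAt (d : F →ₗ[R] F) (hd : Function.Injective d) (n : ℕ) :
    (cplx d).ExactAt (n + 1) := by
  rw [HomologicalComplex.exactAt_iff' _ (n + 1 + 1) (n + 1) n (by simp) (by simp)]
  match n with
  | 0 =>
    rw [ShortComplex.moduleCat_exact_iff]
    intro x hx
    refine ⟨0, ?_⟩
    rw [map_zero]
    exact (hd (hx.trans (map_zero d).symm)).symm
  | n + 1 => exact ShortComplex.exact_of_isZero_X₂ _ (cX_zero (R := R) (F := F) n)

lemma d_π (d : F →ₗ[R] F) (p : F →ₗ[R] M) (h : Function.Exact d p) :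
    (cplx d).d 1 0 ≫ (ModuleCat.ofHom p : (cplx d).X 0 ⟶ ModuleCat.of R M) = 0 := by
  apply ModuleCat.hom_ext
  ext x
  exact h.apply_apply_eq_zero x

/-- The two-term resolution. -/
noncomputable def res [Module.Free R F] (d : F →ₗ[R] F) (p : F →ₗ[R] M)
    (hd : Function.Injective d) (h : Function.Exact d p) (hp : Function.Surjective p) :
    ProjectiveResolution (ModuleCat.of R M) where
  complex := cplx d
  projective := cX_proj
  π := (ChainComplex.toSingle₀Equiv _ _).symm ⟨ModuleCat.ofHom p, d_π d p h⟩
  quasiIso := ⟨fun n => by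
    cases n
    · rw [ChainComplex.quasiIsoAt₀_iff, ShortComplex.quasiIso_iff_of_zeros']
      · constructor
        · rw [ShortComplex.moduleCat_exact_iff]
          intro x hx
          exact (h x).1 hx
        · exact (ModuleCat.epi_iff_surjective _).2 hp
      all_goals rfl
    · rw [quasiIsoAt_iff_exactAt']
      · exact exactAt d hd _
      · apply ChainComplex.exactAt_succ_single_obj⟩

/-- First cohomology of the dual complex. -/
noncomputable def h1 (d : F →ₗ[R] F) 
    (q : (ModuleCat.of R F ⟶ ModuleCat.of R R) →ₗ[R] M)
    (hq : Function.Surjective q)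
    (hqd : ∀ f, q f = 0 ↔ ∃ g : ModuleCat.of R F ⟶ ModuleCat.of R R, ModuleCat.ofHom d ≫ g = f) :
    ((cplx d).linearYonedaObj R (ModuleCat.of R R)).homology 1 ≅ ModuleCat.of R M :=
  let K := (cplx d).linearYonedaObj R (ModuleCat.of R R)
  let q' : (K.sc' 0 1 2).X₂ ⟶ ModuleCat.of R M := ModuleCat.ofHom q
  ShortComplex.homologyMapIso (K.isoSc' 0 1 2 (by simp) (by simp)) ≪≫
    (ShortComplex.LeftHomologyData.ofIsColimitCokernelCofork (K.sc' 0 1 2)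
      (by
        apply ModuleCat.hom_ext
        ext f
        exact (cX_zero (R := R) (F := F) 0).eq_of_src _ _) _
      (ModuleCat.isColimitCokernelCofork (K.sc' 0 1 2).f q' (fun f => hqd f) hq)).homologyIso

end ExtTorsionAux

open ExtTorsionAux in
theorem ext_one_iso_self_of_torsion
    {R : Type} [CommRing R] [IsDomain R] [IsPrincipalIdealRing R]
    (M : Type) [AddCommGroup M] [Module R M] [Module.Finite R M]
    (hM : Module.IsTorsion R M) :
    Nonempty
      ((((Ext R (ModuleCat R) 1).obj (Opposite.op (ModuleCat.of R M))).obj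
          (ModuleCat.of R R)) ≃ₗ[R] M) := by
  classical
  obtain ⟨ι, _, p, hp, e, ⟨φ⟩⟩ := Module.equiv_directSum_of_isTorsion hM
  let a : ι → R := fun i => p i ^ e i
  have ha : ∀ i, a i ≠ 0 := fun i => pow_ne_zero _ (hp i).ne_zero
  let d : (ι → R) →ₗ[R] (ι → R) := LinearMap.pi fun i => a i • LinearMap.proj i
  have hdi : ∀ x i, d x i = a i * x i := fun x i => rfl
  let ψ : (∀ i, R ⧸ Submodule.span R {a i}) ≃ₗ[R] M :=
    (φ.trans (DirectSum.linearEquivFunOnFintype R ι _)).symm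
  let m : (ι → R) →ₗ[R] (∀ i, R ⧸ Submodule.span R {a i}) :=
    LinearMap.pi fun i => (Submodule.mkQ _) ∘ₗ LinearMap.proj i
  let π : (ι → R) →ₗ[R] M := ψ.toLinearMap ∘ₗ m
  have hd : Function.Injective d := by
    intro x y hxy
    funext i
    exact mul_left_cancel₀ (ha i) (congrFun hxy i)
  have hm : Function.Surjective m := by
    intro y
    choose x hx using fun i => Submodule.mkQ_surjective _ (y i)
    exact ⟨x, funext hx⟩
  have hπ : Function.Surjective π := ψ.surjective.comp hm
  have hex : Function.Exact d π := by
    intro x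
    have h1 : π x = 0 ↔ m x = 0 := ψ.map_eq_zero_iff
    have h2 : m x = 0 ↔ ∀ i, ∃ y, y * a i = x i := by
      rw [funext_iff]
      refine forall_congr' fun i => ?_
      exact (Submodule.Quotient.mk_eq_zero _).trans Submodule.mem_span_singleton
    rw [h1, h2]
    constructor
    · intro h
      choose y hy using h
      exact ⟨y, funext fun i => by rw [hdi, mul_comm, hy]⟩
    · rintro ⟨y, rfl⟩ i
      exact ⟨y i, by rw [hdi, mul_comm]⟩
  let b := Pi.basisFun R ι
  -- functionals as coordinate vectors
  let c : (ModuleCat.of R (ι → R) ⟶ ModuleCat.of R R) ≃ₗ[R] (ι → R) :=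
    (ModuleCat.homLinearEquiv (S := R)).trans (b.constr R).symm
  have hc : ∀ f i, c f i = f.hom (Pi.single i 1) := by
    intro f i
    simp [c, b, Module.Basis.constr]
    rfl
  have hcd : ∀ g, c (ModuleCat.ofHom d ≫ g) = d (c g) := by
    intro g
    funext i
    rw [hc, hdi, hc]
    have : d (Pi.single i 1) = a i • Pi.single i 1 := by
      funext j
      rw [hdi]
      by_cases hj : j = i
      · subst hj; simp
      · simp [hj]
    change g.hom (d (Pi.single i 1)) = _
    rw [this, map_smul, smul_eq_mul]
  let q := π ∘ₗ c.toLinearMap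
  refine ⟨(((res d π hd hex hπ).isoExt 1 (ModuleCat.of R R)) ≪≫
    h1 d q (hπ.comp c.surjective) ?_).toLinearEquiv⟩
  intro f
  refine (hex (c f)).trans ?_
  constructor
  · rintro ⟨y, hy⟩
    refine ⟨c.symm y, c.injective ?_⟩
    rw [hcd, c.apply_symm_apply, hy]
  · rintro ⟨g, rfl⟩
    exact ⟨c g, (hcd g).symm⟩
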